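/- arXiv:2211.08123 — 3 statements merged into one kernel-verified Lean document; each statement's English description precedes it below -/
import Mathlib

section
/- Let G be a finite group, χ an irreducible complex character of G that is regular invertible, and χ' a virtual character of G with χ'(1) > 0 such that χ' ≤ χ in Savitskii's preorder (i.e., χ'(1) ≤ χ(1) and χ(g) = 0 implies χ'(g) = 0 for all g ∈ G). Then χ'(1) = χ(1). -/
open scoped ComplexOrder

noncomputable section

/-- `χ : G → ℂ` is an irreducible character: the character of a simple
finite-dimensional complex representation of `G`. -/
def IsIrrChar (G : Type) [Group G] (χ : G → ℂ) : Prop :=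
  ∃ V : FDRep ℂ G, CategoryTheory.Simple V ∧ χ = V.character

/-- A virtual character is a `ℤ`-linear combination of irreducible characters. -/
def IsVirtualChar (G : Type) [Group G] (χ : G → ℂ) : Prop :=
  χ ∈ Submodule.span ℤ {f : G → ℂ | IsIrrChar G f}

open Classical in
/-- The regular character: `|G|` at the identity, `0` elsewhere. -/
def regChar (G : Type) [Group G] : G → ℂ :=
  fun g => if g = 1 then (Nat.card G : ℂ) else 0

/-- The Knutson index of `χ`: the least positive `n` such that `χ·φ = n·ρ_reg`
for some virtual character `φ`. -/
def KnutsonIndex (G : Type) [Group G] (χ : G → ℂ) : ℕ :=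
  sInf {n : ℕ | 0 < n ∧ ∃ φ : G → ℂ, IsVirtualChar G φ ∧ χ * φ = n • regChar G}

/-- `ℂ[G]` is of Knutson type: every irreducible character is regular invertible. -/
def IsKnutsonType (G : Type) [Group G] : Prop :=
  ∀ χ : G → ℂ, IsIrrChar G χ → ∃ φ : G → ℂ, IsVirtualChar G φ ∧ χ * φ = regChar G

/-- Savitskii's preorder: `φ ≤ χ` iff `φ(1) ≤ χ(1)` and every zero of `χ` is a zero of `φ`. -/
def SavitskiiLE (G : Type) [Group G] (φ χ : G → ℂ) : Prop :=
  φ 1 ≤ χ 1 ∧ ∀ g : G, χ g = 0 → φ g = 0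

/-- A virtual character of positive degree is Savitskii-minimal if every virtual
character of positive degree below it is also above it. -/
def SavitskiiMinimal (G : Type) [Group G] (χ : G → ℂ) : Prop :=
  ∀ φ : G → ℂ, IsVirtualChar G φ → 0 < φ 1 → SavitskiiLE G φ χ → SavitskiiLE G χ φ

end

/-- The average over `G` of a product of two virtual characters is an integer. -/
theorem IsVirtualChar.exists_int_sum_mul_eq {G : Type} [Group G] [Fintype G] {α β : G → ℂ}
    (hα : IsVirtualChar G α) (hβ : IsVirtualChar G β) :
    ∃ n : ℤ, ∑ g, α g * β g = n * (Fintype.card G : ℂ) := by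
  unfold IsVirtualChar at hα hβ
  induction hα using Submodule.span_induction with
  | mem α hα =>
    obtain ⟨V, -, rfl⟩ := hα
    induction hβ using Submodule.span_induction with
    | mem β hβ =>
      obtain ⟨W, -, rfl⟩ := hβ
      have hcard : (Nat.card G : ℂ) ≠ 0 := by simp
      have : Invertible (Nat.card G : ℂ) := invertibleOfNonzero hcard
      have key := FDRep.average_char_eq_finrank_invariants (k := ℂ)
        (CategoryTheory.MonoidalCategory.tensorObj V W)
      rw [FDRep.char_tensor] at key
      refine ⟨Module.finrank ℂ (Representation.invariants
        (CategoryTheory.MonoidalCategory.tensorObj V W).ρ), ?_⟩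
      rw [Int.cast_natCast, ← key, ← Nat.card_eq_fintype_card, mul_comm, mul_inv_cancel_left₀ hcard]
      rfl
    | zero => exact ⟨0, by simp⟩
    | add x y _ _ hx hy =>
      obtain ⟨m, hm⟩ := hx
      obtain ⟨n, hn⟩ := hy
      exact ⟨m + n, by simp [mul_add, Finset.sum_add_distrib, hm, hn, add_mul]⟩
    | smul a x _ hx =>
      obtain ⟨m, hm⟩ := hx
      refine ⟨a * m, ?_⟩
      simp only [Pi.smul_apply, zsmul_eq_mul, Int.cast_mul, mul_assoc, ← hm, Finset.mul_sum]
      exact Finset.sum_congr rfl fun g _ => by ring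
  | zero => exact ⟨0, by simp⟩
  | add x y _ _ hx hy =>
    obtain ⟨m, hm⟩ := hx
    obtain ⟨n, hn⟩ := hy
    exact ⟨m + n, by simp [add_mul, Finset.sum_add_distrib, hm, hn]⟩
  | smul a x _ hx =>
    obtain ⟨m, hm⟩ := hx
    refine ⟨a * m, ?_⟩
    simp only [Pi.smul_apply, zsmul_eq_mul, Int.cast_mul, mul_assoc, ← hm, Finset.mul_sum]

/-- If `χ` is a regular-invertible irreducible character and `χ'` is a
virtual character of positive degree with `χ' ≤ χ` in Savitskii's preorder, then
`χ'(1) = χ(1)`. -/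
theorem savitskii_le_regular_invertible_degree_eq {G : Type} [Group G] [Finite G]
    (χ χ' : G → ℂ) (hχ : IsIrrChar G χ)
    (hinv : ∃ φ : G → ℂ, IsVirtualChar G φ ∧ χ * φ = regChar G)
    (hχ' : IsVirtualChar G χ') (hpos : 0 < χ' 1)
    (hle : SavitskiiLE G χ' χ) :
    χ' 1 = χ 1 := by
  classical
  have := Fintype.ofFinite G
  obtain ⟨φ, hφ, hmul⟩ := hinv
  obtain ⟨n, hn⟩ := hχ'.exists_int_sum_mul_eq hφ
  have hzero : ∀ g : G, g ≠ 1 → χ' g * φ g = 0 := by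
    intro g hg
    have h : χ g * φ g = 0 := by simpa [regChar, hg] using congrFun hmul g
    rcases mul_eq_zero.mp h with h | h
    · rw [hle.2 g h, zero_mul]
    · rw [h, mul_zero]
  have hone : χ 1 * φ 1 = Fintype.card G := by
    simpa [regChar, Nat.card_eq_fintype_card] using congrFun hmul 1
  have hφ1 : φ 1 ≠ 0 := by
    intro h
    simp [h, eq_comm] at hone
  rw [Finset.sum_eq_single 1 (fun g _ hg => hzero g hg) (by simp), ← hone, ← mul_assoc] at hn
  have hdvd : χ' 1 = n * χ 1 := mul_right_cancel₀ hφ1 hn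
  have hχ1 : 0 < χ 1 := hpos.trans_le hle.1
  have hn0 : 0 < n := by
    have h : (0 : ℂ) < n := pos_of_mul_pos_left (hdvd ▸ hpos) hχ1.le
    exact_mod_cast h
  have hn1 : n ≤ 1 := by
    have h : (n : ℂ) ≤ 1 := le_of_mul_le_mul_right (by simpa [hdvd] using hle.1) hχ1
    exact_mod_cast h
  obtain rfl : n = 1 := by lia
  simpa using hdvd
end

section
/- The dicyclic group Dic₆ of order 24 (with presentation ⟨a, b | a¹² = 1, b² = a⁶, b·a·b⁻¹ = a⁻¹⟩; Mathlib's QuaternionGroup 6) has an irreducible complex character χ that is regular invertible but not minimal with respect to Savitskii's preorder. In particular, the forward implication of Savitskii's Conjecture fails. -/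
open scoped ComplexOrder

open QuaternionGroup

/-- A matrix representation whose character has norm one affords an irreducible character. -/
theorem IsIrrChar.of_matrix {G : Type} [Group G] [Fintype G] {d : ℕ}
    (ρ : G →* Matrix (Fin d) (Fin d) ℂ)
    (h : ∑ g : G, (ρ g).trace * (ρ g⁻¹).trace = Nat.card G) :
    IsIrrChar G fun g => (ρ g).trace := by
  let σ : Representation ℂ G (Fin d → ℂ) :=
    (Matrix.toLinAlgEquiv' :
      Matrix (Fin d) (Fin d) ℂ ≃ₐ[ℂ] _).toRingEquiv.toRingHom.toMonoidHom.comp ρ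
  have hσ : ∀ g, (FDRep.of σ).character g = (ρ g).trace := fun g =>
    Matrix.trace_toLin'_eq (ρ g)
  refine ⟨FDRep.of σ, ?_, funext fun g => (hσ g).symm⟩
  rw [FDRep.simple_iff_char_is_norm_one]
  simpa only [hσ] using h

namespace QuaternionGroup

variable {n : ℕ}

theorem sum_eq [NeZero n] (f : QuaternionGroup n → ℂ) :
    ∑ g, f g = ∑ i, f (a i) + ∑ i, f (xa i) := by
  let e : ZMod (2 * n) ⊕ ZMod (2 * n) ≃ QuaternionGroup n :=
    { toFun := Sum.elim a xa
      invFun := fun g => match g with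
        | a j => Sum.inl j
        | xa j => Sum.inr j
      left_inv := by rintro (x | x) <;> rfl
      right_inv := by rintro (x | x) <;> rfl }
  rw [← e.sum_comp, Fintype.sum_sum_type]
  rfl

theorem inv_a (i : ZMod (2 * n)) : (a i)⁻¹ = a (-i) := rfl

theorem inv_xa (i : ZMod (2 * n)) : (xa i)⁻¹ = xa ((n : ZMod (2 * n)) + i) := rfl

theorem natCast_add_self (n : ℕ) : (n : ZMod (2 * n)) + n = 0 := by
  rw [← two_mul]
  exact_mod_cast ZMod.natCast_self (2 * n)

/-- The function extending an additive character of `ZMod (2 * n)` to the quaternion group, with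
value one at `xa 0`. -/
def linearChar (ψ : AddChar (ZMod (2 * n)) ℂ) : QuaternionGroup n → ℂ
  | a i => ψ i
  | xa i => ψ i

/-- The function induced from an additive character of the cyclic subgroup of index two. -/
def inducedChar (ψ : AddChar (ZMod (2 * n)) ℂ) : QuaternionGroup n → ℂ
  | a i => ψ i + ψ (-i)
  | xa _ => 0

/-- The matrix form of the representation induced from the cyclic subgroup of index two. -/
def inducedMatrix (ψ : AddChar (ZMod (2 * n)) ℂ) :
    QuaternionGroup n →* Matrix (Fin 2) (Fin 2) ℂ where
  toFun
    | a i => !![ψ i, 0; 0, ψ (-i)]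
    | xa i => !![0, ψ (n - i); ψ i, 0]
  map_one' := by
    rw [one_def]
    ext i j
    fin_cases i <;> fin_cases j <;> simp
  map_mul' := by
    have hn := natCast_add_self n
    rintro (i | i) (j | j) <;> ext r s <;> fin_cases r <;> fin_cases s <;>
      simp [Matrix.mul_apply, ← AddChar.map_add_eq_mul] <;> congr 1 <;> grind

theorem isIrrChar_linearChar [NeZero n] (ψ : AddChar (ZMod (2 * n)) ℂ)
    (hψ : ∀ i, ψ (-i) = ψ i) (hn : ψ n = 1) : IsIrrChar (QuaternionGroup n) (linearChar ψ) := by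
  let ρ : QuaternionGroup n →* Matrix (Fin 1) (Fin 1) ℂ :=
    (Matrix.scalar (Fin 1)).toMonoidHom.comp
      { toFun := linearChar ψ
        map_one' := ψ.map_zero_eq_one
        map_mul' := by
          rintro (i | i) (j | j) <;>
            simp [linearChar, AddChar.map_add_eq_mul, sub_eq_add_neg, hψ, hn, mul_comm] }
  have hρ : ∀ g, (ρ g).trace = linearChar ψ g := fun g => by
    simp [ρ, Matrix.trace]; rfl
  have key := IsIrrChar.of_matrix ρ (by
    have hsq : ∀ i, ψ i * ψ i = 1 := fun i => by
      nth_rw 2 [← hψ i]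
      rw [← AddChar.map_add_eq_mul, add_neg_cancel, AddChar.map_zero_eq_one]
    simp only [hρ, sum_eq, inv_a, inv_xa, linearChar, AddChar.map_add_eq_mul, hψ, hn, one_mul, hsq]
    simp [Nat.card_eq_fintype_card, card, ZMod.card]
    ring)
  simpa only [hρ] using key

theorem isIrrChar_inducedChar [NeZero n] (ψ : AddChar (ZMod (2 * n)) ℂ) (hψ : ψ * ψ ≠ 1) :
    IsIrrChar (QuaternionGroup n) (inducedChar ψ) := by
  have hρ : ∀ g, (inducedMatrix ψ g).trace = inducedChar ψ g := by
    rintro (i | i) <;> simp [inducedMatrix, inducedChar, Matrix.trace_fin_two]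
  have key := IsIrrChar.of_matrix (inducedMatrix ψ) (by
    have h0 : ∑ i, ψ i * ψ i = 0 := AddChar.sum_eq_zero_of_ne_one hψ
    have h1 : ∑ i, ψ (-i) * ψ (-i) = 0 := by
      rw [← h0]
      exact Equiv.sum_comp (Equiv.neg (ZMod (2 * n))) fun i => ψ i * ψ i
    have h2 : ∀ i, (ψ i + ψ (-i)) * (ψ (-i) + ψ i) = ψ i * ψ i + ψ (-i) * ψ (-i) + 2 := fun i => by
      have : ψ i * ψ (-i) = 1 := by
        rw [← AddChar.map_add_eq_mul, add_neg_cancel, AddChar.map_zero_eq_one]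
      linear_combination 2 * this
    simp only [hρ, sum_eq, inv_a, inv_xa, inducedChar, neg_neg, h2, Finset.sum_add_distrib, h0, h1]
    simp [Nat.card_eq_fintype_card, card, ZMod.card]
    ring)
  simpa only [hρ] using key

end QuaternionGroup

theorem ZMod.stdAddChar_eq_one_iff {N : ℕ} [NeZero N] (j : ZMod N) :
    ZMod.stdAddChar j = (1 : ℂ) ↔ j = 0 := by
  rw [← AddChar.map_zero_eq_one (ZMod.stdAddChar (N := N)), ZMod.injective_stdAddChar.eq_iff]

theorem ZMod.stdAddChar_twelve_six : ZMod.stdAddChar (6 : ZMod (2 * 6)) = (-1 : ℂ) := by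
  have h : ZMod.stdAddChar (6 : ZMod (2 * 6)) * ZMod.stdAddChar (6 : ZMod (2 * 6)) = (1 : ℂ) := by
    rw [← AddChar.map_add_eq_mul, ZMod.stdAddChar_eq_one_iff]
    decide
  refine (mul_self_eq_one_iff.mp h).resolve_left ?_
  rw [ZMod.stdAddChar_eq_one_iff]
  decide

/-- The additive characters of `ZMod 12`, indexed by `ZMod 12`. -/
noncomputable def twelfthChar (k : ZMod (2 * 6)) : AddChar (ZMod (2 * 6)) ℂ :=
  AddChar.mulShift ZMod.stdAddChar k

theorem isIrrChar_inducedChar_twelfthChar (k : ZMod (2 * 6)) (hk : k + k ≠ 0) :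
    IsIrrChar (QuaternionGroup 6) (inducedChar (twelfthChar k)) := by
  refine isIrrChar_inducedChar _ fun h => hk ?_
  have := DFunLike.congr_fun h 1
  rwa [twelfthChar, AddChar.mulShift_mul, AddChar.mulShift_apply, mul_one, AddChar.one_apply,
    ZMod.stdAddChar_eq_one_iff] at this

theorem isIrrChar_linearChar_twelfthChar (k : ZMod (2 * 6)) (hk : k + k = 0) :
    IsIrrChar (QuaternionGroup 6) (linearChar (twelfthChar k)) := by
  refine isIrrChar_linearChar _ (fun i => ?_) ?_
  · simp only [twelfthChar, AddChar.mulShift_apply]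
    congr 1
    linear_combination (-i) * hk
  · rw [twelfthChar, AddChar.mulShift_apply, ZMod.stdAddChar_eq_one_iff]
    revert k
    decide

/-- A virtual character of `QuaternionGroup 6` restricting to the regular character of the cyclic
subgroup of index two. -/
noncomputable def extendedRegChar : QuaternionGroup 6 → ℂ :=
  linearChar (twelfthChar 0) + linearChar (twelfthChar 6) + inducedChar (twelfthChar 1) +
    inducedChar (twelfthChar 2) + inducedChar (twelfthChar 3) + inducedChar (twelfthChar 4) +
    inducedChar (twelfthChar 5)

theorem isVirtualChar_extendedRegChar : IsVirtualChar (QuaternionGroup 6) extendedRegChar := by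
  have hl (k : ZMod (2 * 6)) (hk : k + k = 0) :
      IsVirtualChar (QuaternionGroup 6) (linearChar (twelfthChar k)) :=
    Submodule.subset_span (isIrrChar_linearChar_twelfthChar k hk)
  have hi (k : ZMod (2 * 6)) (hk : k + k ≠ 0) :
      IsVirtualChar (QuaternionGroup 6) (inducedChar (twelfthChar k)) :=
    Submodule.subset_span (isIrrChar_inducedChar_twelfthChar k hk)
  exact add_mem (add_mem (add_mem (add_mem (add_mem (add_mem (hl 0 (by decide)) (hl 6 (by decide)))
    (hi 1 (by decide))) (hi 2 (by decide))) (hi 3 (by decide))) (hi 4 (by decide)))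
    (hi 5 (by decide))

theorem extendedRegChar_a (i : ZMod (2 * 6)) :
    extendedRegChar (a i) = if i = 0 then 12 else 0 := by
  have h := AddChar.sum_mulShift i (ZMod.isPrimitive_stdAddChar (2 * 6))
  have hs : ∀ f : ZMod (2 * 6) → ℂ, ∑ k, f k = f 0 + f 6 + (f 1 + f (-1)) + (f 2 + f (-2)) +
      (f 3 + f (-3)) + (f 4 + f (-4)) + (f 5 + f (-5)) := fun f => by
    have : (Finset.univ : Finset (ZMod (2 * 6))) =
        {0, 6, 1, -1, 2, -2, 3, -3, 4, -4, 5, -5} := by decide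
    rw [this]
    repeat rw [Finset.sum_insert (by decide)]
    rw [Finset.sum_singleton]
    ring
  rw [hs] at h
  simp only [neg_mul] at h
  simp only [extendedRegChar, Pi.add_apply, linearChar, inducedChar, twelfthChar,
    AddChar.mulShift_apply, mul_neg, h, ZMod.card]
  norm_num

theorem inducedChar_mul_extendedRegChar (ψ : AddChar (ZMod (2 * 6)) ℂ) :
    inducedChar ψ * extendedRegChar = regChar (QuaternionGroup 6) := by
  funext g
  rcases g with i | i
  · by_cases hi : i = 0
    · subst hi
      simp [regChar, extendedRegChar_a, inducedChar, Nat.card_eq_fintype_card, QuaternionGroup.card,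
        -a_zero, one_def]
      norm_num
    · simp [regChar, extendedRegChar_a, inducedChar, hi, one_def, -a_zero]
  · simp [regChar, inducedChar, one_def, -a_zero]

/-- The dicyclic group `Dic₆` of order `24` (Mathlib's
`QuaternionGroup 6`) has an irreducible character that is regular invertible but not
Savitskii-minimal: the forward implication of Savitskii's conjecture fails. -/
theorem dic6_regular_invertible_not_minimal :
    ∃ χ : QuaternionGroup 6 → ℂ, IsIrrChar (QuaternionGroup 6) χ ∧
      (∃ φ : QuaternionGroup 6 → ℂ, IsVirtualChar (QuaternionGroup 6) φ ∧
        χ * φ = regChar (QuaternionGroup 6)) ∧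
      ¬ SavitskiiMinimal (QuaternionGroup 6) χ := by
  have hdeg (k : ZMod (2 * 6)) : inducedChar (twelfthChar k) 1 = 2 := by
    rw [one_def, inducedChar, neg_zero, AddChar.map_zero_eq_one]
    norm_num
  refine ⟨inducedChar (twelfthChar 2), isIrrChar_inducedChar_twelfthChar 2 (by decide),
    ⟨extendedRegChar, isVirtualChar_extendedRegChar, inducedChar_mul_extendedRegChar _⟩,
    fun hmin => ?_⟩
  have h6 := ZMod.stdAddChar_twelve_six
  have h2 : inducedChar (twelfthChar 2) (a 3) = -2 := by
    simp only [inducedChar, twelfthChar, AddChar.mulShift_apply]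
    rw [show (2 * 3 : ZMod (2 * 6)) = 6 by decide, show (2 * -3 : ZMod (2 * 6)) = 6 by decide, h6]
    norm_num
  have h1 : inducedChar (twelfthChar 1) (a 3) = 0 := by
    simp only [inducedChar, twelfthChar, AddChar.mulShift_apply, one_mul]
    rw [show (-3 : ZMod (2 * 6)) = 6 + 3 by decide, AddChar.map_add_eq_mul, h6]
    ring
  have hle := hmin (inducedChar (twelfthChar 1))
    (Submodule.subset_span (isIrrChar_inducedChar_twelfthChar 1 (by decide)))
    (by rw [hdeg]; exact two_pos) ⟨by rw [hdeg, hdeg], ?_⟩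
  · have := hle.2 (a 3) h1
    rw [h2] at this
    norm_num at this
  · rintro (i | i) hi
    · exfalso
      simp only [inducedChar, twelfthChar, AddChar.mulShift_apply] at hi
      have h : ZMod.stdAddChar (2 * i + 2 * i + 6) = (1 : ℂ) := by
        have hinv : ZMod.stdAddChar (2 * i) * ZMod.stdAddChar (2 * -i) = (1 : ℂ) := by
          rw [← AddChar.map_add_eq_mul, mul_neg, add_neg_cancel, AddChar.map_zero_eq_one]
        rw [AddChar.map_add_eq_mul, AddChar.map_add_eq_mul, h6]
        linear_combination hinv - ZMod.stdAddChar (2 * i) * hi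
      rw [ZMod.stdAddChar_eq_one_iff] at h
      clear hi
      revert i
      decide
    · rfl
end

section
/- Let ρ be the (unique) irreducible complex character of degree 2 of the symmetric group S₄, and let S be a Sylow 2-subgroup of S₄ (so |S| = 8 and S is isomorphic to the dihedral group of order 8). Then for every pair of integers u, v with 2u + 8v = 2, the virtual character ν = u·(ρ restricted to S) + v·ρ_reg^S of S (which has ν(1) = 2) is not minimal with respect to Savitskii's preorder. In particular, the Savitskii restriction does not preserve minimality. -/
open scoped ComplexOrder

open DihedralGroup in
/-- The action of the dihedral group of order `8` on the vertices of the square. -/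
def dihedralPerm : DihedralGroup 4 →* Equiv.Perm (Fin 4) where
  toFun
    | r i => finRotate 4 ^ i.val
    | sr i => Equiv.swap 1 3 * finRotate 4 ^ i.val
  map_one' := by decide
  map_mul' := by
    rintro (i | i) (j | j) <;> revert i j <;> decide

theorem dihedralPerm_injective : Function.Injective dihedralPerm := by
  rw [injective_iff_map_eq_one]
  rintro (i | i) <;> revert i <;> decide

open DihedralGroup in
/-- The dihedral group of order `8` as the group of integral orthogonal `2 × 2` matrices. -/
def dihedralMatrix : DihedralGroup 4 →* Matrix (Fin 2) (Fin 2) ℤ where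
  toFun
    | r i => !![0, -1; 1, 0] ^ i.val
    | sr i => !![1, 0; 0, -1] * !![0, -1; 1, 0] ^ i.val
  map_one' := by decide
  map_mul' := by
    rintro (i | i) (j | j) <;> revert i j <;> decide

theorem trace_dihedralMatrix_one : (dihedralMatrix 1).trace = 2 := by decide

theorem trace_dihedralMatrix_eq_zero :
    ∀ x, x ≠ 1 → x ≠ DihedralGroup.r 2 → (dihedralMatrix x).trace = 0 := by
  rintro (i | i) <;> revert i <;> decide

theorem sum_trace_dihedralMatrix_mul_inv :
    ∑ x, (dihedralMatrix x).trace * (dihedralMatrix x⁻¹).trace = 8 := by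
  rw [← DihedralGroup.equivSum.symm.sum_comp, Fintype.sum_sum_type]
  decide

/-- The standard two-dimensional complex representation of a group isomorphic to the dihedral
group of order `8`. -/
noncomputable def standardRep {G : Type} [Group G] (e : G ≃* DihedralGroup 4) : FDRep ℂ G :=
  FDRep.of (V := Fin 2 → ℂ) (Matrix.toLinAlgEquiv'.toAlgHom.toRingHom.toMonoidHom.comp
    ((Int.castRingHom ℂ).mapMatrix.toMonoidHom.comp (dihedralMatrix.comp (e : G →* _))))

theorem character_standardRep {G : Type} [Group G] (e : G ≃* DihedralGroup 4) (g : G) :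
    (standardRep e).character g = ((dihedralMatrix (e g)).trace : ℂ) := by
  have h : (standardRep e).character g = LinearMap.trace ℂ (Fin 2 → ℂ)
    (Matrix.toLin' ((dihedralMatrix (e g)).map (Int.cast : ℤ → ℂ))) := rfl
  rw [h, Matrix.trace_toLin'_eq]
  simp [Matrix.trace]

theorem simple_standardRep {G : Type} [Group G] (e : G ≃* DihedralGroup 4) :
    CategoryTheory.Simple (standardRep e) := by
  have : Fintype G := Fintype.ofEquiv _ e.symm.toEquiv
  rw [FDRep.simple_iff_char_is_norm_one]
  simp_rw [character_standardRep, map_inv]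
  rw [e.bijective.sum_comp (fun x => ((dihedralMatrix x).trace : ℂ) * (dihedralMatrix x⁻¹).trace),
    Nat.card_congr e.toEquiv, DihedralGroup.nat_card]
  exact_mod_cast sum_trace_dihedralMatrix_mul_inv

/-- A `2 × 2` matrix that squares to the identity and has determinant one has nonzero trace. -/
theorem Matrix.trace_ne_zero_of_mul_self_eq_one {K : Type*} [Field K] [CharZero K]
    (A : Matrix (Fin 2) (Fin 2) K) (hA : A * A = 1) (hdet : A.det = 1) : A.trace ≠ 0 := by
  intro h
  have h00 := congrFun (congrFun hA 0) 0
  simp only [Matrix.mul_apply, Fin.sum_univ_two, Matrix.one_apply_eq] at h00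
  rw [Matrix.det_fin_two] at hdet
  rw [Matrix.trace_fin_two] at h
  have : (2 : K) = 0 := by linear_combination -h00 - hdet + A 0 0 * h
  exact two_ne_zero this

open scoped commutatorElement in
theorem character_commutator_ne_zero {G : Type} [Group G] (V : FDRep ℂ G)
    (hV : V.character 1 = 2) (a b : G) (hab : ⁅a, b⁆ * ⁅a, b⁆ = 1) :
    V.character ⁅a, b⁆ ≠ 0 := by
  have hrank : Module.finrank ℂ V = 2 := by
    rw [FDRep.char_one] at hV
    exact_mod_cast hV
  let B := Module.finBasisOfFinrankEq ℂ V hrank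
  let M : G →* Matrix (Fin 2) (Fin 2) ℂ := (LinearMap.toMatrixAlgEquiv B : _ →* _).comp V.ρ
  have htr : V.character ⁅a, b⁆ = (M ⁅a, b⁆).trace :=
    LinearMap.trace_eq_matrix_trace ℂ B _
  rw [htr]
  apply Matrix.trace_ne_zero_of_mul_self_eq_one
  · rw [← map_mul, hab, map_one]
  · have h := map_commutatorElement ((Matrix.detMonoidHom.comp M).toHomUnits) a b
    rw [commutatorElement_eq_one_iff_commute.2 (Commute.all (_ : ℂˣ) _)] at h
    exact congrArg Units.val h

open scoped Pointwise in
/-- A subgroup of order `8` of `S₄` is conjugate to the symmetry group of the square. -/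
theorem exists_mulEquiv_dihedralGroup (S : Subgroup (Equiv.Perm (Fin 4)))
    (hS : Nat.card S = 8) :
    ∃ (e : S ≃* DihedralGroup 4) (c : Equiv.Perm (Fin 4)),
      ∀ s : S, (s : Equiv.Perm (Fin 4)) = c * dihedralPerm (e s) * c⁻¹ := by
  have : Fact (Nat.Prime 2) := ⟨Nat.prime_two⟩
  have hfact : 2 ^ (Nat.card (Equiv.Perm (Fin 4))).factorization 2 = 8 := by
    have h24 : Nat.card (Equiv.Perm (Fin 4)) = 2 ^ 3 * 3 := by
      simp [Fintype.card_perm, Nat.factorial]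
    rw [h24, Nat.factorization_mul (by norm_num) (by norm_num), Nat.Prime.factorization_pow
      Nat.prime_two]
    simp [Nat.factorization_eq_zero_of_not_dvd]
  have hD : Nat.card dihedralPerm.range = 8 := by
    rw [← Nat.card_congr (MonoidHom.ofInjective dihedralPerm_injective).toEquiv,
      DihedralGroup.nat_card]
  obtain ⟨c, hc⟩ := MulAction.exists_smul_eq (Equiv.Perm (Fin 4))
    (Sylow.ofCard dihedralPerm.range (hD.trans hfact.symm))
    (Sylow.ofCard S (hS.trans hfact.symm))
  have hc' : MulAut.conj c • dihedralPerm.range = S := congrArg Sylow.toSubgroup hc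
  subst hc'
  let e := (MonoidHom.ofInjective dihedralPerm_injective).trans
    (Subgroup.equivSMul (MulAut.conj c) dihedralPerm.range)
  refine ⟨e.symm, c, fun s => ?_⟩
  obtain ⟨x, rfl⟩ := e.surjective s
  rw [e.symm_apply_apply]
  rfl

open scoped commutatorElement in
theorem dihedralPerm_r_two_eq_commutator :
    dihedralPerm (.r 2) = ⁅(Equiv.swap 1 3 : Equiv.Perm (Fin 4)), finRotate 4⁆ := by
  decide

open scoped commutatorElement in
theorem dihedralPerm_sr_one_eq_commutator :
    dihedralPerm (.sr 1) = ⁅(Equiv.swap 0 3 : Equiv.Perm (Fin 4)), Equiv.swap 0 1 * Equiv.swap 2 3⁆ := by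
  decide

/-- Let `ρ` be the irreducible character of degree `2` of `S₄` and `S`
a Sylow `2`-subgroup of `S₄` (of order `8`).  For all integers `u, v` with
`2u + 8v = 2`, the Savitskii restriction `ν = u·(ρ|_S) + v·ρ_reg^S` is not
Savitskii-minimal: Savitskii restriction does not preserve minimality. -/
theorem savitskii_restriction_not_minimal
    (ρ : Equiv.Perm (Fin 4) → ℂ) (hρ : IsIrrChar (Equiv.Perm (Fin 4)) ρ)
    (hdeg : ρ 1 = 2)
    (S : Subgroup (Equiv.Perm (Fin 4))) (hS : Nat.card S = 8)
    (u v : ℤ) (huv : 2 * u + 8 * v = 2) :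
    ¬ SavitskiiMinimal S (u • (fun s : S => ρ (s : Equiv.Perm (Fin 4))) + v • regChar S) := by
  obtain ⟨V, -, rfl⟩ := hρ
  obtain ⟨e, c, he⟩ := exists_mulEquiv_dihedralGroup S hS
  have hu : (u : ℂ) ≠ 0 := by
    have : u ≠ 0 := by omega
    exact_mod_cast this
  have hone : (u • (fun s : S => V.character (s : Equiv.Perm (Fin 4))) + v • regChar S) 1 = 2 := by
    have h : (2 * u + 8 * v : ℂ) = 2 := by exact_mod_cast huv
    rw [Pi.add_apply, Pi.smul_apply, Pi.smul_apply, zsmul_eq_mul, zsmul_eq_mul, regChar,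
      if_pos rfl, OneMemClass.coe_one, hdeg, hS]
    push_cast
    linear_combination h
  have hne_one (s : S) (hs : s ≠ 1) :
      (u • (fun s : S => V.character (s : Equiv.Perm (Fin 4))) + v • regChar S) s =
        u * V.character (dihedralPerm (e s)) := by
    simp [regChar, hs, he s, FDRep.char_conj]
  have hr : V.character (dihedralPerm (.r 2)) ≠ 0 := by
    rw [dihedralPerm_r_two_eq_commutator]
    exact character_commutator_ne_zero V hdeg _ _ (by decide)
  have hsr : V.character (dihedralPerm (.sr 1)) ≠ 0 := by
    rw [dihedralPerm_sr_one_eq_commutator]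
    exact character_commutator_ne_zero V hdeg _ _ (by decide)
  have hχ_one : (standardRep e).character 1 = 2 := by
    rw [character_standardRep, map_one, trace_dihedralMatrix_one]
    norm_num
  intro hmin
  have hle := hmin (standardRep e).character
    (Submodule.subset_span ⟨_, simple_standardRep e, rfl⟩) (by rw [hχ_one]; norm_num)
    ⟨by rw [hχ_one, hone], fun s hs => ?_⟩
  · have hs : e.symm (.sr 1) ≠ 1 := by
      rw [Ne, EmbeddingLike.map_eq_one_iff]
      decide
    have h := hle.2 (e.symm (.sr 1)) (by
      rw [character_standardRep, e.apply_symm_apply,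
        trace_dihedralMatrix_eq_zero _ (by decide) (by decide), Int.cast_zero])
    rw [hne_one _ hs, e.apply_symm_apply] at h
    exact mul_ne_zero hu hsr h
  · have hs1 : s ≠ 1 := by
      rintro rfl
      rw [hone] at hs
      exact two_ne_zero hs
    rw [hne_one s hs1] at hs
    rw [character_standardRep, trace_dihedralMatrix_eq_zero _ (by simpa using hs1), Int.cast_zero]
    intro h
    rw [h] at hs
    exact mul_ne_zero hu hr hs
end
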